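/- arXiv:quant-ph/0402154 — 2 statements merged into one kernel-verified Lean document; each statement's English description precedes it below -/
import Mathlib

section
/- The spin transport matrices are special unitary: let C : ℝ → ℝ³ and let D : ℝ → Matrix (Fin 2) (Fin 2) ℂ satisfy D(0) = I₂ and, for every t ∈ ℝ, HasDerivAt D (−(i/2)·((C t)·σ)·D(t)) t (the spin transport equation Ḋ + (i/2)(C·σ)D = 0). Then for every t ∈ ℝ, D(t)ᴴ·D(t) = I₂ and det D(t) = 1; i.e. D(t) ∈ SU(2). -/
open Matrix Complex

noncomputable section

/-- The Pauli matrices `σ₁, σ₂, σ₃` as `2 × 2` complex matrices. -/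
def pauli : Fin 3 → Matrix (Fin 2) (Fin 2) ℂ
  | 0 => !![0, 1; 1, 0]
  | 1 => !![0, -Complex.I; Complex.I, 0]
  | 2 => !![1, 0; 0, -1]

/-- `v·σ = v₁σ₁ + v₂σ₂ + v₃σ₃`. -/
def pauliVec (v : Fin 3 → ℝ) : Matrix (Fin 2) (Fin 2) ℂ :=
  (v 0 : ℂ) • pauli 0 + (v 1 : ℂ) • pauli 1 + (v 2 : ℂ) • pauli 2

attribute [local instance] Matrix.normedAddCommGroup Matrix.normedSpace

/-- The entries of a differentiable matrix-valued curve are differentiable. -/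
theorem HasDerivAt.matrix_apply {m n : Type*} [Fintype m] [Fintype n]
    {A : ℝ → Matrix m n ℂ} {A' : Matrix m n ℂ} {t : ℝ} (h : HasDerivAt A A' t)
    (i : m) (j : n) : HasDerivAt (fun s => A s i j) (A' i j) t :=
  hasDerivAt_pi.1 (hasDerivAt_pi.1 h i) j

theorem eq_of_hasDerivAt_zero {f : ℝ → ℂ} (h : ∀ t, HasDerivAt f 0 t) (t : ℝ) : f t = f 0 :=
  is_const_of_deriv_eq_zero (fun s => (h s).differentiableAt) (fun s => (h s).deriv) t 0

theorem pauliVec_eq (v : Fin 3 → ℝ) :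
    pauliVec v = !![(v 2 : ℂ), v 0 - v 1 * Complex.I; v 0 + v 1 * Complex.I, -(v 2 : ℂ)] := by
  ext i j
  fin_cases i <;> fin_cases j <;> simp [pauliVec, pauli, sub_eq_add_neg]

/-- solutions of the spin transport equation
`Ḋ + (i/2)(C·σ)D = 0`, `D(0) = I₂`, are special unitary: `D(t) ∈ SU(2)` for
all `t`. -/
theorem spinTransport_mem_SU2 (C : ℝ → Fin 3 → ℝ)
    (D : ℝ → Matrix (Fin 2) (Fin 2) ℂ) (hD0 : D 0 = 1)
    (hD : ∀ t : ℝ, HasDerivAt D (-((Complex.I / 2) • (pauliVec (C t) * D t))) t) :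
    ∀ t : ℝ, (D t)ᴴ * D t = 1 ∧ (D t).det = 1 := by
  have hE := fun s i j => (hD s).matrix_apply i j
  intro t
  constructor
  · ext i j
    have hconst : ((D t)ᴴ * D t) i j = ((D 0)ᴴ * D 0) i j := by
      refine eq_of_hasDerivAt_zero (f := fun s => ((D s)ᴴ * D s) i j) (fun s => ?_) t
      have h := ((hE s 0 i).star.mul (hE s 0 j)).add ((hE s 1 i).star.mul (hE s 1 j))
      simp only [Matrix.mul_apply, Fin.sum_univ_two, Matrix.conjTranspose_apply]
      refine h.congr_deriv ?_
      simp [pauliVec_eq, Matrix.vecMul, dotProduct, Fin.sum_univ_two]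
      ring
    simpa [hD0] using hconst
  · have hconst : (D t).det = (D 0).det := by
      refine eq_of_hasDerivAt_zero (f := fun s => (D s).det) (fun s => ?_) t
      have h := ((hE s 0 0).mul (hE s 1 1)).sub ((hE s 0 1).mul (hE s 1 0))
      simp only [Matrix.det_fin_two]
      refine h.congr_deriv ?_
      simp [pauliVec_eq, Matrix.vecMul, dotProduct, Fin.sum_univ_two]
      ring
    simpa [hD0] using hconst

end
end

section
/- Thomas precession from spin transport: let C : ℝ → ℝ³ and let D : ℝ → Matrix (Fin 2) (Fin 2) ℂ satisfy D(0) = I₂ and, for every t ∈ ℝ, HasDerivAt D (−(i/2)·((C t)·σ)·D(t)) t. Fix n₀ ∈ ℝ³ and define n : ℝ → ℝ³ by n(t)_k := ½·Re(trace(D(t)·(n₀·σ)·D(t)ᴴ·σ_k)) for k = 1,2,3. Then n(0) = n₀ and, for every t ∈ ℝ, HasDerivAt n (C(t) ×₃ n(t)) t, where ×₃ denotes the cross product on ℝ³; i.e. n obeys the precession equation ṅ = C × n. -/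
open Matrix Complex

noncomputable section

attribute [local instance] Matrix.normedAddCommGroup Matrix.normedSpace

theorem pauliVec_conjTranspose (v : Fin 3 → ℝ) : (pauliVec v)ᴴ = pauliVec v := by
  ext i j
  fin_cases i <;> fin_cases j <;> simp [pauliVec, pauli]

theorem half_re_trace_pauliVec_mul_pauli (v : Fin 3 → ℝ) (k : Fin 3) :
    (1 / 2 : ℝ) * (pauliVec v * pauli k).trace.re = v k := by
  fin_cases k <;> simp [pauliVec, pauli, Matrix.trace, Fin.sum_univ_two] <;> ring

theorem half_re_trace_commutator_mul_pauli (c : Fin 3 → ℝ) (M : Matrix (Fin 2) (Fin 2) ℂ)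
    (k : Fin 3) :
    (1 / 2 : ℝ) * ((-(I / 2) • (pauliVec c * M - M * pauliVec c)) * pauli k).trace.re =
      crossProduct c (fun l => (1 / 2 : ℝ) * (M * pauli l).trace.re) k := by
  fin_cases k <;>
    simp [crossProduct, pauliVec, pauli, Matrix.trace, Matrix.mul_apply, Matrix.vecMul, dotProduct,
      Fin.sum_univ_two] <;>
    ring

theorem hasDerivAt_matrix_iff {m n : Type*} [Fintype m] [Fintype n]
    {F : ℝ → Matrix m n ℂ} {F' : Matrix m n ℂ} {t : ℝ} :
    HasDerivAt F F' t ↔ ∀ i j, HasDerivAt (fun s => F s i j) (F' i j) t :=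
  hasDerivAt_pi.trans (forall_congr' fun _ => hasDerivAt_pi)

theorem HasDerivAt.matrix_mul {l m n : Type*} [Fintype l] [Fintype m] [Fintype n]
    {F : ℝ → Matrix l m ℂ} {F' : Matrix l m ℂ} {G : ℝ → Matrix m n ℂ} {G' : Matrix m n ℂ} {t : ℝ}
    (hF : HasDerivAt F F' t) (hG : HasDerivAt G G' t) :
    HasDerivAt (fun s => F s * G s) (F' * G t + F t * G') t := by
  rw [hasDerivAt_matrix_iff] at *
  intro i j
  simp only [Matrix.add_apply, Matrix.mul_apply, ← Finset.sum_add_distrib]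
  exact HasDerivAt.fun_sum fun a _ => (hF i a).fun_mul (hG a j)

theorem HasDerivAt.matrix_conjTranspose {m n : Type*} [Fintype m] [Fintype n]
    {F : ℝ → Matrix m n ℂ} {F' : Matrix m n ℂ} {t : ℝ} (hF : HasDerivAt F F' t) :
    HasDerivAt (fun s => (F s)ᴴ) F'ᴴ t := by
  rw [hasDerivAt_matrix_iff] at *
  exact fun i j => (hF j i).star

theorem HasDerivAt.matrix_trace {n : Type*} [Fintype n]
    {F : ℝ → Matrix n n ℂ} {F' : Matrix n n ℂ} {t : ℝ} (hF : HasDerivAt F F' t) :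
    HasDerivAt (fun s => (F s).trace) F'.trace t :=
  HasDerivAt.fun_sum fun i _ => hasDerivAt_matrix_iff.1 hF i i

/-- If `D` solves the spin transport equation, then `D A Dᴴ` solves the von Neumann equation. -/
theorem hasDerivAt_conj_of_spin_transport {c : Fin 3 → ℝ} {D : ℝ → Matrix (Fin 2) (Fin 2) ℂ}
    {t : ℝ} (hD : HasDerivAt D (-((I / 2) • (pauliVec c * D t))) t)
    (A : Matrix (Fin 2) (Fin 2) ℂ) :
    HasDerivAt (fun s => D s * A * (D s)ᴴ)
      (-(I / 2) • (pauliVec c * (D t * A * (D t)ᴴ) - D t * A * (D t)ᴴ * pauliVec c)) t := by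
  have h := (hD.matrix_mul (hasDerivAt_const t A)).matrix_mul hD.matrix_conjTranspose
  convert h using 1
  have hI : star (I / 2) = -(I / 2) := by simp [neg_div]
  simp only [conjTranspose_neg, conjTranspose_smul, conjTranspose_mul, pauliVec_conjTranspose, hI,
    mul_zero, add_zero, neg_smul, neg_neg, neg_mul, smul_mul_assoc, mul_smul_comm, smul_sub,
    Matrix.mul_assoc]
  abel

/-- Thomas precession from spin transport: if `D` solves the spin
transport equation `Ḋ + (i/2)(C·σ)D = 0`, `D(0) = I₂`, then the spin vector
`n(t)_k = ½ Re tr(D(t)(n₀·σ)D(t)ᴴ σ_k)` satisfies `n(0) = n₀` and the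
precession equation `ṅ = C × n`. -/
theorem thomas_precession (C : ℝ → Fin 3 → ℝ)
    (D : ℝ → Matrix (Fin 2) (Fin 2) ℂ) (hD0 : D 0 = 1)
    (hD : ∀ t : ℝ, HasDerivAt D (-((Complex.I / 2) • (pauliVec (C t) * D t))) t)
    (n₀ : Fin 3 → ℝ) (n : ℝ → Fin 3 → ℝ)
    (hn : ∀ t : ℝ, ∀ k : Fin 3,
      n t k = (1 / 2 : ℝ) * ((D t * pauliVec n₀ * (D t)ᴴ * pauli k).trace).re) :
    n 0 = n₀ ∧ ∀ t : ℝ, HasDerivAt n (crossProduct (C t) (n t)) t := by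
  constructor
  · ext k
    rw [hn, hD0]
    simpa using half_re_trace_pauliVec_mul_pauli n₀ k
  · intro t
    rw [hasDerivAt_pi]
    intro k
    have h := ((hasDerivAt_conj_of_spin_transport (hD t) (pauliVec n₀)).matrix_mul
      (hasDerivAt_const t (pauli k))).matrix_trace
    have hre := (reCLM.hasFDerivAt.comp_hasDerivAt t h).const_mul (1 / 2 : ℝ)
    rw [funext fun s => hn s k, funext (hn t), ← half_re_trace_commutator_mul_pauli]
    simpa using hre

end
end
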